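/- arXiv:2001.10435 — 2 statements merged into one kernel-verified Lean document; each statement's English description precedes it below -/
import Mathlib

section
/- Let a = p₁^{n₁} ⋯ p_s^{n_s} be the Lyndon factorization of a word a with p₁ < ⋯ < p_s Lyndon words of lengths l₁,...,l_s. For an (l₁,...,l₁,...,l_s,...,l_s)-shuffle w (block lengths repeated with multiplicities nᵢ), the shuffled word equals a if and only if w permutes, for each i, only the nᵢ blocks corresponding to copies of pᵢ among themselves (i.e., w lies in the subgroup Σ_{n₁} × ⋯ × Σ_{n_s} of block permutations). -/
/-- Lexicographic strict order on words, with the convention that a word is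
strictly greater than each of its proper prefixes (i.e. `a ++ b < a`). -/
def wlt {X : Type*} [LinearOrder X] : List X → List X → Prop
  | [], _ => False
  | _ :: _, [] => True
  | x :: xs, y :: ys => x < y ∨ (x = y ∧ wlt xs ys)

/-- A nonempty word `p` is a Lyndon word if every proper nonempty suffix of `p`
is strictly less than `p`. -/
def IsLyndon {X : Type*} [LinearOrder X] (p : List X) : Prop :=
  p ≠ [] ∧ ∀ u v : List X, u ≠ [] → v ≠ [] → p = u ++ v → wlt v p

/-- `w` is an `(m₁,…,m_r)`-shuffle (block sizes given by the list `l`):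
it is strictly increasing on each of the consecutive blocks of sizes `m₁,…,m_r`. -/
def IsShuffle (l : List ℕ) {n : ℕ} (w : Equiv.Perm (Fin n)) : Prop :=
  ∀ (b : ℕ) (i j : Fin n), (l.take b).sum ≤ (i : ℕ) → (i : ℕ) < (j : ℕ) →
    (j : ℕ) < (l.take (b + 1)).sum → w i < w j

/-- `w` is a "block permutation" for the factor list `fs`: there is a
permutation `τ` of the blocks sending each block to the position of an equal
block (so, for each `i`, permuting the `nᵢ` copies of `pᵢ` among themselves),
and `w` moves the letters of block `b` to the corresponding positions inside
block `τ b`. -/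
def IsBlockPerm {X : Type*} (fs : List (List X)) {n : ℕ}
    (w : Equiv.Perm (Fin n)) : Prop :=
  ∃ τ : Equiv.Perm (Fin fs.length),
    (∀ b : Fin fs.length, fs.get (τ b) = fs.get b) ∧
    ∀ (b : Fin fs.length) (m : ℕ), m < (fs.get b).length →
      ∀ (hi : ((fs.map List.length).take b).sum + m < n)
        (hj : ((fs.map List.length).take (τ b)).sum + m < n),
        w ⟨((fs.map List.length).take b).sum + m, hi⟩ =
          ⟨((fs.map List.length).take (τ b)).sum + m, hj⟩

section LexOrder

variable {X : Type*} [LinearOrder X]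

theorem wlt_irrefl (a : List X) : ¬ wlt a a := by
  induction a with
  | nil => simp [wlt]
  | cons x xs ih => simp [wlt, ih]

theorem wlt_trans {a b c : List X} (hab : wlt a b) (hbc : wlt b c) : wlt a c := by
  induction a generalizing b c with
  | nil => simp [wlt] at hab
  | cons x xs ih =>
    cases b with
    | nil => simp [wlt] at hbc
    | cons y ys =>
      cases c with
      | nil => simp [wlt]
      | cons t ts =>
        simp only [wlt] at *
        rcases hab with h | ⟨rfl, h⟩ <;> rcases hbc with h' | ⟨rfl, h'⟩
        · exact Or.inl (h.trans h')
        · exact Or.inl h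
        · exact Or.inl h'
        · exact Or.inr ⟨rfl, ih h h'⟩

theorem wlt_trichotomy (a b : List X) : wlt a b ∨ a = b ∨ wlt b a := by
  induction a generalizing b with
  | nil => cases b <;> simp [wlt]
  | cons x xs ih =>
    cases b with
    | nil => simp [wlt]
    | cons y ys =>
      simp only [wlt, List.cons.injEq]
      rcases lt_trichotomy x y with h | rfl | h
      · exact Or.inl (Or.inl h)
      · rcases ih ys with h | h | h <;> simp [h]
      · exact Or.inr (Or.inr (Or.inl h))

theorem wlt_of_not_wlt_of_wlt {a b c : List X} (hba : ¬ wlt b a) (hbc : wlt b c) :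
    wlt a c := by
  rcases wlt_trichotomy a b with h | rfl | h
  · exact wlt_trans h hbc
  · exact hbc
  · exact absurd h hba

theorem wlt_of_wlt_of_not_wlt {a b c : List X} (hab : wlt a b) (hcb : ¬ wlt c b) :
    wlt a c := by
  rcases wlt_trichotomy b c with h | rfl | h
  · exact wlt_trans hab h
  · exact hab
  · exact absurd h hcb

theorem wlt_asymm {a b : List X} (hab : wlt a b) : ¬ wlt b a :=
  fun h => wlt_irrefl _ (wlt_trans hab h)

theorem not_wlt_trans {a b c : List X} (hab : ¬ wlt a b) (hbc : ¬ wlt b c) : ¬ wlt a c :=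
  fun h => hbc (wlt_of_not_wlt_of_wlt hab h)

theorem wlt_append_left_iff (c a b : List X) : wlt (c ++ a) (c ++ b) ↔ wlt a b := by
  induction c with
  | nil => simp
  | cons x xs ih => simp [wlt, ih]

theorem wlt_nil {a : List X} (h : a ≠ []) : wlt a [] := by
  cases a with
  | nil => exact absurd rfl h
  | cons x xs => simp [wlt]

theorem wlt_append_self (a : List X) {b : List X} (h : b ≠ []) : wlt (a ++ b) a := by
  simpa using (wlt_append_left_iff a b []).2 (wlt_nil h)

theorem not_wlt_append (a b : List X) : ¬ wlt a (a ++ b) := fun h => by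
  have := (wlt_append_left_iff a [] b).1 (by simpa using h)
  cases b <;> simp [wlt] at this

/-- If `q < l`, either `l` is a proper prefix of `q`, or the words differ at some letter and the
comparison is insensitive to what is appended. -/
theorem wlt_prefix_or_append {q l : List X} (h : wlt q l) :
    (∃ r, r ≠ [] ∧ q = l ++ r) ∨ ∀ c d, wlt (q ++ d) (l ++ c) := by
  induction q generalizing l with
  | nil => simp [wlt] at h
  | cons x xs ih =>
    cases l with
    | nil => exact Or.inl ⟨_, by simp, rfl⟩
    | cons y ys =>
      rcases h with h | ⟨rfl, h⟩
      · exact Or.inr fun c d => Or.inl h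
      · rcases ih h with ⟨r, hr, rfl⟩ | h'
        · exact Or.inl ⟨r, hr, rfl⟩
        · exact Or.inr fun c d => Or.inr ⟨rfl, h' c d⟩

theorem wlt_append_append {q l : List X} (h : wlt q l) (hlen : q.length ≤ l.length)
    (c d : List X) : wlt (q ++ d) (l ++ c) := by
  rcases wlt_prefix_or_append h with ⟨r, hr, rfl⟩ | h'
  · simp at hlen
    exact absurd hlen hr
  · exact h' c d

end LexOrder

section Lyndon

variable {X : Type*} [LinearOrder X]

theorem IsLyndon.append {l m : List X} (hl : IsLyndon l) (hm : IsLyndon m) (h : wlt m l) :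
    IsLyndon (l ++ m) := by
  have hmlm : wlt m (l ++ m) := by
    rcases wlt_prefix_or_append h with ⟨r, hr, hmr⟩ | h'
    · have h1 := hm.2 l r hl.1 hr hmr
      have h2 := (wlt_append_left_iff l r m).2 h1
      rwa [← hmr] at h2
    · simpa using h' m []
  refine ⟨by simp [hl.1], fun u v hu hv huv => ?_⟩
  rcases List.append_eq_append_iff.1 huv with ⟨s, rfl, hs⟩ | ⟨s, hs, rfl⟩
  · rcases eq_or_ne s [] with rfl | hs0
    · simp only [List.nil_append] at hs
      exact hs ▸ hmlm
    · exact wlt_trans (hm.2 s v hs0 hv hs) hmlm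
  · rcases eq_or_ne s [] with rfl | hs0
    · simpa using hmlm
    · refine wlt_append_append (hl.2 u s hu hs0 hs) ?_ _ _
      simp [hs]

theorem exists_lyndon_factorization_append (A : List (List X)) :
    ∀ l, IsLyndon l → (∀ m ∈ A, IsLyndon m) → A.Pairwise (fun a b => ¬ wlt b a) →
    ∃ B : List (List X), (∀ m ∈ B, IsLyndon m) ∧ B.Pairwise (fun a b => ¬ wlt b a) ∧
      B.flatten = l ++ A.flatten := by
  induction A with
  | nil => exact fun l hl _ _ => ⟨[l], by simpa using hl, by simp, by simp⟩
  | cons m A ih =>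
    intro l hl hA hs
    rw [List.forall_mem_cons] at hA
    rw [List.pairwise_cons] at hs
    by_cases h : wlt m l
    · obtain ⟨B, h1, h2, h3⟩ := ih (l ++ m) (hl.append hA.1 h) hA.2 hs.2
      exact ⟨B, h1, h2, by simp [h3]⟩
    · refine ⟨l :: m :: A, ?_, ?_, by simp⟩
      · simpa [hl] using hA
      · refine List.pairwise_cons.2 ⟨?_, List.pairwise_cons.2 hs⟩
        rw [List.forall_mem_cons]
        exact ⟨h, fun k hk => not_wlt_trans (hs.1 k hk) h⟩

/-- Every word is a product of a weakly monotone sequence of Lyndon words. -/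
theorem exists_lyndon_factorization (u : List X) :
    ∃ A : List (List X), (∀ m ∈ A, IsLyndon m) ∧ A.Pairwise (fun a b => ¬ wlt b a) ∧
      A.flatten = u := by
  induction u with
  | nil => exact ⟨[], by simp, by simp, rfl⟩
  | cons x u ih =>
    obtain ⟨A, h1, h2, rfl⟩ := ih
    refine exists_lyndon_factorization_append A [x] ⟨by simp, fun u v hu hv huv => ?_⟩ h1 h2
    have := congrArg List.length huv
    have := List.length_pos_iff.2 hu
    have := List.length_pos_iff.2 hv
    simp at *
    omega

theorem exists_lyndon_prefix_factorization {u : List X} (hu : u ≠ []) :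
    ∃ (l : List X) (A : List (List X)), IsLyndon l ∧ (∀ k ∈ A, ¬ wlt k l) ∧
      u = l ++ A.flatten := by
  obtain ⟨_ | ⟨l, A⟩, h1, h2, rfl⟩ := exists_lyndon_factorization u
  · exact absurd rfl hu
  · exact ⟨l, A, h1 l (by simp), (List.pairwise_cons.1 h2).1, rfl⟩

theorem wlt_flatten {p : List X} (A : List (List X)) (hA : ∀ l ∈ A, wlt p l) :
    ∀ r, r ≠ [] → (∀ u v, v ≠ [] → r = u ++ v → ¬ wlt p v) → wlt r A.flatten := by
  induction A with
  | nil => exact fun r hr _ => wlt_nil hr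
  | cons l A ih =>
    intro r hr h
    rw [List.forall_mem_cons] at hA
    have hrl : wlt r l := wlt_of_not_wlt_of_wlt (h [] r hr rfl) hA.1
    rcases wlt_prefix_or_append hrl with ⟨s, hs, rfl⟩ | h'
    · rw [List.flatten_cons, wlt_append_left_iff]
      exact ih hA.2 s hs fun u v hv huv => h (l ++ u) v hv (by simp [huv])
    · simpa using h' A.flatten []

/-- A product of words each below the Lyndon word `p` is again below `p`. -/
theorem IsLyndon.wlt_flatten {p : List X} (hp : IsLyndon p) {A : List (List X)}
    (hA : ∀ l ∈ A, wlt p l) : wlt p A.flatten := by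
  refine _root_.wlt_flatten A hA p hp.1 fun u v hv huv => ?_
  rcases eq_or_ne u [] with rfl | hu
  · simpa [huv] using wlt_irrefl v
  · exact fun h => wlt_irrefl _ (wlt_trans h (hp.2 u v hu hv huv))

end Lyndon

section Shuffle

variable {X : Type*} [LinearOrder X] {β : Type*}

theorem not_wlt_of_append {a b q : List X} (h : ¬ wlt (a ++ b) q) : ¬ wlt a q :=
  not_wlt_trans (not_wlt_append a b) h

theorem not_wlt_of_append_eq {a b c d : List X} (h : a ++ b = c ++ d)
    (hlen : a.length ≤ c.length) : ¬ wlt a c := by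
  obtain ⟨t, rfl⟩ := List.prefix_of_prefix_length_le ⟨b, rfl⟩ ⟨d, h.symm⟩ hlen
  exact not_wlt_append a t

theorem length_filter_add_length_filter_not (z : List β) (P : β → Bool) :
    (z.filter P).length + (z.filter fun c => !P c).length = z.length := by
  simpa using (List.length_eq_length_filter_add P (l := z)).symm

/-- Inductive step of `shuffle_bound`: the first Lyndon factor `l` of the word on `P` is at least
the first Lyndon factor `m` of the word on the complement of `P`. -/
theorem shuffle_bound_step (f : β → X) (z : List β)
    (ih : ∀ y : List β, y.length < z.length → ∀ (P : β → Bool) (q : List X), IsLyndon q →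
      ¬ wlt ((y.filter P).map f) q → ¬ wlt ((y.filter fun c => !P c).map f) q →
      y.length ≤ q.length → ¬ wlt (y.map f) q ∧
        (y.map f = q → y.filter P = [] ∨ (y.filter fun c => !P c) = []))
    (P : β → Bool) {q l m : List X} {A B : List (List X)} (hq : IsLyndon q) (hl : IsLyndon l)
    (hm : IsLyndon m) (hA : ∀ k ∈ A, ¬ wlt k l) (hB : ∀ k ∈ B, ¬ wlt k m) (hml : ¬ wlt m l)
    (hu : (z.filter P).map f = l ++ A.flatten)
    (hv : (z.filter fun c => !P c).map f = m ++ B.flatten)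
    (huq : ¬ wlt (l ++ A.flatten) q) (hvq : ¬ wlt (m ++ B.flatten) q)
    (hlen : z.length ≤ q.length) : wlt q (z.map f) := by
  have hsum := length_filter_add_length_filter_not z P
  have hul := congrArg List.length hu
  have hvl := congrArg List.length hv
  have hl0 := List.length_pos_iff.2 hl.1
  have hm0 := List.length_pos_iff.2 hm.1
  simp only [List.length_map, List.length_append] at hul hvl
  have hlq : wlt q l := by
    rcases wlt_trichotomy q l with h | rfl | h
    · exact h
    · omega
    · exact absurd h (not_wlt_of_append huq)
  obtain ⟨z₁, z₂, rfl, hz₁⟩ : ∃ z₁ z₂, z = z₁ ++ z₂ ∧ z₁.length = l.length :=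
    ⟨z.take l.length, z.drop l.length, (List.take_append_drop _ _).symm, by simp; omega⟩
  simp only [List.filter_append, List.map_append, List.length_append] at *
  have hlow : m = l ∨ wlt l (m ++ B.flatten) := by
    rcases wlt_trichotomy m l with h | h | h
    · exact absurd h hml
    · exact Or.inl h
    · refine Or.inr (hl.wlt_flatten (A := m :: B) ?_)
      rw [List.forall_mem_cons]
      exact ⟨h, fun k hk => wlt_of_wlt_of_not_wlt h (hB k hk)⟩
  have hlow1 : ¬ wlt ((z₁.filter fun c => !P c).map f) l := by
    rcases hlow with rfl | h
    · exact not_wlt_of_append_eq hv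
        (by rw [List.length_map]; exact (List.length_filter_le _ _).trans hz₁.le)
    · rw [← hv] at h
      exact not_wlt_of_append (wlt_asymm h)
  have hup1 : ¬ wlt ((z₁.filter P).map f) l := not_wlt_of_append_eq hu
        (by rw [List.length_map]; exact (List.length_filter_le _ _).trans hz₁.le)
  obtain ⟨h1, h2⟩ := ih z₁ (by omega) P l hl hup1 hlow1 hz₁.le
  rcases wlt_trichotomy (z₁.map f) l with h | h | h
  · exact absurd h h1
  · have key : ¬ wlt (z₂.map f) q := by
      have below : ∀ C : List (List X), (∀ k ∈ C, ¬ wlt k l) → ¬ wlt C.flatten q := fun C hC =>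
        wlt_asymm (hq.wlt_flatten fun k hk => wlt_of_wlt_of_not_wlt hlq (hC k hk))
      suffices ¬ wlt ((z₂.filter P).map f) q ∧ ¬ wlt ((z₂.filter fun c => !P c).map f) q from
        (ih z₂ (by omega) P q hq this.1 this.2 (by omega)).1
      rcases h2 h with h0 | h0
      · have hall : (z₁.filter fun c => !P c) = z₁ := by
          simpa [List.filter_eq_nil_iff, List.filter_eq_self] using h0
        rw [h0] at hu
        rw [hall, h] at hv
        rcases hlow with rfl | h'
        · rw [List.append_cancel_left hv]
          exact ⟨by simpa [← hu] using huq, below B hB⟩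
        · rw [← hv] at h'
          exact absurd h' (not_wlt_append _ _)
      · have hall : z₁.filter P = z₁ := by
          simpa [List.filter_eq_nil_iff, List.filter_eq_self] using h0
        rw [h0] at hv
        rw [hall, h] at hu
        rw [List.append_cancel_left hu]
        exact ⟨below A hA, by simpa [← hv] using hvq⟩
    rw [h]
    rcases wlt_prefix_or_append hlq with ⟨r, hr, rfl⟩ | h'
    · rw [wlt_append_left_iff]
      exact wlt_of_wlt_of_not_wlt (hq.2 l r hl.1 hr rfl) key
    · simpa using h' (z₂.map f) []
  · refine wlt_trans hlq ?_
    simpa using wlt_append_append h (by simp [hz₁]) (z₂.map f) []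

/-- If a word no longer than the Lyndon word `q` is a shuffle of two words which are at most `q`,
then it is at most `q`, and equality forces one of the two words to be empty. -/
theorem shuffle_bound (f : β → X) (z : List β) (P : β → Bool) (q : List X) (hq : IsLyndon q)
    (hu : ¬ wlt ((z.filter P).map f) q) (hv : ¬ wlt ((z.filter fun c => !P c).map f) q)
    (hlen : z.length ≤ q.length) :
    ¬ wlt (z.map f) q ∧ (z.map f = q → z.filter P = [] ∨ (z.filter fun c => !P c) = []) := by
  induction hn : z.length using Nat.strong_induction_on generalizing z P q with
  | _ n ih =>
    subst hn
    by_cases hu0 : z.filter P = []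
    · have hall : (z.filter fun c => !P c) = z := by
        simpa [List.filter_eq_nil_iff, List.filter_eq_self] using hu0
      exact ⟨by rwa [hall] at hv, fun _ => Or.inl hu0⟩
    by_cases hv0 : (z.filter fun c => !P c) = []
    · have hall : z.filter P = z := by
        simpa [List.filter_eq_nil_iff, List.filter_eq_self] using hv0
      exact ⟨by rwa [hall] at hu, fun _ => Or.inr hv0⟩
    suffices h : wlt q (z.map f) from
      ⟨wlt_asymm h, fun h' => absurd h (h' ▸ wlt_irrefl _)⟩
    have ih' := fun (y : List β) (hy : y.length < z.length) (P : β → Bool) (q : List X) hq hu hv hl =>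
      ih y.length hy y P q hq hu hv hl rfl
    obtain ⟨l, A, hl, hA, hlA⟩ :=
      exists_lyndon_prefix_factorization (u := (z.filter P).map f) (by simpa using hu0)
    obtain ⟨m, B, hm, hB, hmB⟩ :=
      exists_lyndon_prefix_factorization (u := (z.filter fun c => !P c).map f) (by simpa using hv0)
    by_cases hml : wlt m l
    · refine shuffle_bound_step f z ih' (fun c => !P c) hq hm hl hB hA (wlt_asymm hml) hmB
        (by simpa using hlA) (hmB ▸ hv) (hlA ▸ hu) hlen
    · exact shuffle_bound_step f z ih' P hq hl hm hA hB hml hlA hmB (hlA ▸ hu) (hmB ▸ hv) hlen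

/-- If a word no longer than the Lyndon word `q` is a shuffle of words (indexed by colours) which
are at most `q`, then it is at most `q`, and equality forces a single colour. -/
theorem shuffle_bound_colours {ι : Type*} [DecidableEq ι] (f : β → X) (col : β → ι) (z : List β)
    (q : List X) (hq : IsLyndon q) (h : ∀ i, ¬ wlt ((z.filter fun c => col c = i).map f) q)
    (hlen : z.length ≤ q.length) :
    ¬ wlt (z.map f) q ∧ (z.map f = q → ∃ i, ∀ c ∈ z, col c = i) := by
  induction hn : z.length using Nat.strong_induction_on generalizing z with
  | _ n ih =>
    subst hn
    cases z with
    | nil => exact ⟨by simp [wlt], fun h0 => absurd h0.symm hq.1⟩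
    | cons c z =>
      set y := (c :: z).filter fun d => !decide (col d = col c) with hy
      have hlt : y.length < (c :: z).length := by
        have := List.length_filter_le (fun d => !decide (col d = col c)) z
        simp [hy]
        omega
      have hy' : ∀ i, ¬ wlt ((y.filter fun d => col d = i).map f) q := by
        intro i
        by_cases hi : i = col c
        · have : (y.filter fun d => col d = i) = [] := by
            rw [List.filter_eq_nil_iff]
            intro d hd
            have := (List.mem_filter.1 hd).2
            simpa [hi] using this
          simp [this, wlt]
        · have : (y.filter fun d => col d = i) = (c :: z).filter fun d => col d = i := by
            rw [hy, List.filter_filter]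
            refine List.filter_congr fun d _ => ?_
            by_cases hd : col d = i <;> simp [hd, hi]
          rw [this]
          exact h i
      obtain ⟨h1, h2⟩ := shuffle_bound f (c :: z) (fun d => col d = col c) q hq (h _)
        (ih _ hlt y hy' (by omega) rfl).1 hlen
      refine ⟨h1, fun he => ⟨col c, ?_⟩⟩
      rcases h2 he with h3 | h3
      · simp at h3
      · simpa [List.filter_eq_nil_iff] using h3

end Shuffle

section Blocks

variable {X : Type*} [LinearOrder X] {β ι : Type*} [DecidableEq ι]

/-- A shuffle of Lyndon blocks spelling the product of the blocks in weakly monotone order is a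
concatenation of entire blocks. -/
theorem exists_block_order (f : β → X) (col : β → ι) (cells : ι → List β) (L : List (List X)) :
    ∀ (S : List ι) (z : List β), (∀ q ∈ L, IsLyndon q) → L.Pairwise (fun a b => ¬ wlt b a) →
      S.Nodup → L.Perm (S.map fun i => (cells i).map f) →
      (∀ i ∈ S, (z.filter fun c => col c = i) = cells i) → (∀ c ∈ z, col c ∈ S) →
      z.map f = L.flatten →
      ∃ T : List ι, T.Perm S ∧ (T.map fun i => (cells i).map f) = L ∧ z = T.flatMap cells := by
  induction L with
  | nil =>
    intro S z _ _ _ hLS _ _ hz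
    have hS : S = [] := by simpa using hLS.symm.eq_nil
    exact ⟨[], by simp [hS], rfl, by simpa using hz⟩
  | cons q L ih =>
    intro S z hL hsort hS hLS hcells hcol hz
    rw [List.forall_mem_cons] at hL
    rw [List.pairwise_cons] at hsort
    have hle : ∀ i ∈ S, ¬ wlt ((cells i).map f) q := by
      intro i hi
      have : (cells i).map f ∈ q :: L := hLS.mem_iff.2 (List.mem_map_of_mem hi)
      rcases List.mem_cons.1 this with h | h
      · rw [h]
        exact wlt_irrefl q
      · exact hsort.1 _ h
    have hq0 := List.length_pos_iff.2 hL.1.1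
    rw [List.flatten_cons, List.map_eq_append_iff] at hz
    obtain ⟨z₁, z₂, rfl, hz₁, hz₂⟩ := hz
    have hlen : z₁.length = q.length := by rw [← hz₁, List.length_map]
    simp only [List.filter_append, List.forall_mem_append] at hcells hcol
    obtain ⟨i, hi⟩ := (shuffle_bound_colours f col z₁ q hL.1 (fun j => by
      by_cases hj : j ∈ S
      · have := hle j hj
        rw [← hcells j hj, List.map_append] at this
        exact not_wlt_of_append this
      · have : (z₁.filter fun c => col c = j) = [] := by
          rw [List.filter_eq_nil_iff]
          intro c hc
          have := hcol.1 c hc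
          rintro h
          simp only [decide_eq_true_eq] at h
          exact hj (h ▸ this)
        simp [this, wlt]) hlen.le).2 hz₁
    obtain ⟨c₀, hc₀⟩ := List.exists_mem_of_length_pos (hlen ▸ hq0)
    have hiS : i ∈ S := hi c₀ hc₀ ▸ hcol.1 c₀ hc₀
    have hz₁i : (z₁.filter fun c => col c = i) = z₁ := by
      simpa [List.filter_eq_self] using hi
    have hz₂i : (z₂.filter fun c => col c = i) = [] := by
      by_contra hne
      refine hle i hiS ?_
      rw [← hcells i hiS, hz₁i, List.map_append, hz₁]
      exact wlt_append_self q (by simpa using hne)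
    have hci : cells i = z₁ := by rw [← hcells i hiS, hz₁i, hz₂i, List.append_nil]
    have hperm := List.perm_cons_erase hiS
    have hLS' : L.Perm ((S.erase i).map fun i => (cells i).map f) := by
      have := hLS.trans (hperm.map _)
      rw [List.map_cons, hci, hz₁] at this
      exact this.cons_inv
    obtain ⟨T, hT, hTL, rfl⟩ := ih (S.erase i) z₂ hL.2 hsort.2 (hS.erase i) hLS'
      (fun j hj => by
        rw [hS.mem_erase_iff] at hj
        rw [← hcells j hj.2, List.self_eq_append_left, List.filter_eq_nil_iff]
        intro c hc
        simpa [hi c hc] using hj.1.symm)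
      (fun c hc => by
        rw [hS.mem_erase_iff]
        exact ⟨by simpa using (List.filter_eq_nil_iff.1 hz₂i) c hc, hcol.2 c hc⟩) hz₂
    exact ⟨i :: T, (hT.cons i).trans hperm.symm, by simp [hTL, hci, hz₁], by simp [hci]⟩

end Blocks

section Positions

theorem exists_eq_sum_take_add (l : List ℕ) {s : ℕ} (hs : s < l.sum) :
    ∃ b, ∃ h : b < l.length, ∃ m < l[b], s = (l.take b).sum + m := by
  induction l generalizing s with
  | nil => simp at hs
  | cons a l ih =>
    by_cases h : s < a
    · exact ⟨0, by simp, s, by simpa using h, by simp⟩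
    · obtain ⟨b, hb, m, hm, h'⟩ := ih (s := s - a) (by simp at hs; omega)
      exact ⟨b + 1, by simpa using hb, m, by simpa using hm, by simp; omega⟩

theorem sum_take_add_lt (l : List ℕ) {b m : ℕ} (hb : b < l.length) (hm : m < l[b]) :
    (l.take b).sum + m < (l.take (b + 1)).sum := by
  rw [List.sum_take_succ _ _ hb]
  omega

theorem sum_take_le_sum_take (l : List ℕ) {b c : ℕ} (h : b ≤ c) :
    (l.take b).sum ≤ (l.take c).sum :=
  (List.take_sublist_take_left h).sum_le_sum (by simp)

theorem sum_take_add_lt_sum (l : List ℕ) {b m : ℕ} (hb : b < l.length) (hm : m < l[b]) :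
    (l.take b).sum + m < l.sum := by
  have h := sum_take_le_sum_take l (show b + 1 ≤ l.length from hb)
  rw [List.take_length] at h
  exact (sum_take_add_lt l hb hm).trans_le h

theorem sum_take_add_inj (l : List ℕ) {b c m k : ℕ} (hb : b < l.length) (hc : c < l.length)
    (hm : m < l[b]) (hk : k < l[c]) (h : (l.take b).sum + m = (l.take c).sum + k) : b = c := by
  have h1 := sum_take_add_lt l hb hm
  have h2 := sum_take_add_lt l hc hk
  by_contra hne
  rcases Nat.lt_or_gt_of_ne hne with h' | h'
  · have := sum_take_le_sum_take l (show b + 1 ≤ c from h')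
    omega
  · have := sum_take_le_sum_take l (show c + 1 ≤ b from h')
    omega

theorem getElem?_flatten_sum_take_add {α : Type*} (M : List (List α)) {b m : ℕ}
    (hb : b < M.length) (hm : m < M[b].length) :
    M.flatten[((M.map List.length).take b).sum + m]? = M[b][m]? := by
  induction M generalizing b with
  | nil => simp at hb
  | cons a M ih =>
    cases b with
    | zero =>
      simp at hm ⊢
      rw [List.getElem?_append_left hm, List.getElem?_eq_getElem hm]
    | succ b =>
      simp at hm hb
      have := ih hb hm
      simp only [List.map_cons, List.take_succ_cons, List.sum_cons, List.flatten_cons,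
        List.getElem_cons_succ, add_assoc]
      rw [List.getElem?_append_right (by omega), Nat.add_sub_cancel_left, this]

end Positions

section BlockPosition

variable {X : Type*}

/-- The position in `fs.flatten` of the `m`-th letter of the block `b`. -/
def blockPosition (fs : List (List X)) (b : Fin fs.length) (m : ℕ) (hm : m < (fs.get b).length) :
    Fin fs.flatten.length :=
  ⟨((fs.map List.length).take b).sum + m, by
    rw [List.length_flatten]
    exact sum_take_add_lt_sum _ (by simp) (by simpa using hm)⟩

theorem exists_eq_blockPosition (fs : List (List X)) (s : Fin fs.flatten.length) :
    ∃ b m hm, s = blockPosition fs b m hm := by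
  obtain ⟨b, hb, m, hm, h⟩ := exists_eq_sum_take_add (fs.map List.length) (s := s)
    (by rw [← List.length_flatten]; exact s.2)
  exact ⟨⟨b, by simpa using hb⟩, m, by simpa using hm, Fin.ext h⟩

theorem get_blockPosition (fs : List (List X)) (b : Fin fs.length) (m : ℕ)
    (hm : m < (fs.get b).length) :
    fs.flatten.get (blockPosition fs b m hm) = (fs.get b)[m] := by
  have := getElem?_flatten_sum_take_add fs b.2 hm
  rw [List.getElem?_eq_getElem (show m < fs[(b : ℕ)].length from hm)] at this
  exact (List.getElem_eq_iff (blockPosition fs b m hm).2).2 this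

theorem blockPosition_inj (fs : List (List X)) {b c : Fin fs.length} {m k : ℕ}
    {hm : m < (fs.get b).length} {hk : k < (fs.get c).length}
    (h : blockPosition fs b m hm = blockPosition fs c k hk) : b = c :=
  Fin.ext <| sum_take_add_inj (fs.map List.length) (by simp) (by simp) (by simpa using hm)
    (by simpa using hk) (Fin.val_eq_of_eq h)

/-- The positions in `fs.flatten` of the letters of the block `b`. -/
def blockPositions (fs : List (List X)) (b : Fin fs.length) : List (Fin fs.flatten.length) :=
  List.ofFn fun m : Fin (fs.get b).length => blockPosition fs b m m.2

theorem mem_blockPositions (fs : List (List X)) (b : Fin fs.length) (s : Fin fs.flatten.length) :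
    s ∈ blockPositions fs b ↔ ∃ m hm, s = blockPosition fs b m hm := by
  simp only [blockPositions, List.mem_ofFn]
  exact ⟨fun ⟨m, h⟩ => ⟨m, m.2, h.symm⟩, fun ⟨m, hm, h⟩ => ⟨⟨m, hm⟩, h.symm⟩⟩

theorem map_get_blockPositions (fs : List (List X)) (b : Fin fs.length) :
    (blockPositions fs b).map fs.flatten.get = fs.get b := by
  refine List.ext_getElem (by simp [blockPositions]) fun m h₁ h₂ => ?_
  simpa [blockPositions] using get_blockPosition fs b m h₂

theorem pairwise_blockPositions (fs : List (List X)) (b : Fin fs.length) :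
    (blockPositions fs b).Pairwise (· < ·) := by
  rw [blockPositions, List.pairwise_ofFn]
  intro m k h
  exact Nat.add_lt_add_left h _

theorem ofFn_symm_eq_of_isBlockPerm (fs : List (List X))
    (w : Equiv.Perm (Fin fs.flatten.length)) (h : IsBlockPerm fs w) :
    (List.ofFn fun j => fs.flatten.get (w.symm j)) = fs.flatten := by
  obtain ⟨τ, hτ, hw⟩ := h
  have key : ∀ s, fs.flatten.get s = fs.flatten.get (w s) := by
    intro s
    obtain ⟨b, m, hm, rfl⟩ := exists_eq_blockPosition fs s
    have hm' : m < (fs.get (τ b)).length := hτ b ▸ hm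
    have : w (blockPosition fs b m hm) = blockPosition fs (τ b) m hm' := hw b m hm _ _
    rw [this, get_blockPosition, get_blockPosition]
    simp only [hτ b]
  conv_rhs => rw [← List.ofFn_get fs.flatten]
  congr 1
  funext j
  simpa using key (w.symm j)

theorem filter_symm_eq_blockPositions (fs : List (List X))
    (w : Equiv.Perm (Fin fs.flatten.length)) (hw : IsShuffle (fs.map List.length) w)
    (col : Fin fs.flatten.length → Fin fs.length)
    (hcol : ∀ b m hm, col (blockPosition fs b m hm) = b) (b : Fin fs.length) :
    ((List.ofFn w.symm).filter fun s => col s = b) = blockPositions fs b := by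
  have hlt : ((List.ofFn w.symm).filter fun s => col s = b).Pairwise (· < ·) := by
    rw [List.pairwise_filter, List.pairwise_ofFn]
    intro i j hij hi hj
    simp only [decide_eq_true_eq] at hi hj
    obtain ⟨c, m, hm, hc⟩ := exists_eq_blockPosition fs (w.symm i)
    obtain ⟨d, k, hk, hd⟩ := exists_eq_blockPosition fs (w.symm j)
    obtain rfl : c = b := by rw [← hi, hc, hcol]
    obtain rfl : d = c := by rw [← hj, hd, hcol]
    by_contra hle
    have hne : w.symm i ≠ w.symm j := fun h => hij.ne (w.symm.injective h)
    have hlt : w.symm j < w.symm i := lt_of_le_of_ne (not_lt.1 hle) hne.symm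
    have := hw d (w.symm j) (w.symm i) (by simp [hd, blockPosition]) hlt (by
      rw [hc]
      exact sum_take_add_lt _ (by simp) (by simpa using hm))
    simp only [Equiv.apply_symm_apply] at this
    exact absurd hij this.not_gt
  refine List.Perm.eq_of_pairwise (le := (· < ·)) (fun a b _ _ h h' => absurd h h'.not_gt) hlt
    (pairwise_blockPositions fs b) ?_
  rw [List.perm_ext_iff_of_nodup (hlt.imp ne_of_lt) ((pairwise_blockPositions fs b).imp ne_of_lt)]
  intro s
  rw [mem_blockPositions, List.mem_filter]
  simp only [decide_eq_true_eq]
  constructor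
  · rintro ⟨-, h⟩
    obtain ⟨c, m, hm, rfl⟩ := exists_eq_blockPosition fs s
    rw [hcol] at h
    subst h
    exact ⟨m, hm, rfl⟩
  · rintro ⟨m, hm, rfl⟩
    exact ⟨List.mem_ofFn.2 ⟨w _, w.symm_apply_apply _⟩, hcol b m hm⟩

theorem isBlockPerm_of_ofFn_symm_eq [LinearOrder X] (fs : List (List X))
    (hL : ∀ q ∈ fs, IsLyndon q) (hs : fs.Pairwise fun a b => ¬ wlt b a)
    (w : Equiv.Perm (Fin fs.flatten.length)) (hw : IsShuffle (fs.map List.length) w)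
    (h : (List.ofFn fun j => fs.flatten.get (w.symm j)) = fs.flatten) : IsBlockPerm fs w := by
  obtain ⟨col, hcol⟩ : ∃ col : Fin fs.flatten.length → Fin fs.length,
      ∀ b m hm, col (blockPosition fs b m hm) = b := by
    choose col m hm h using exists_eq_blockPosition fs
    exact ⟨col, fun b k hk => (blockPosition_inj fs (h (blockPosition fs b k hk))).symm⟩
  obtain ⟨T, hT, hTfs, hz⟩ := exists_block_order fs.flatten.get col (blockPositions fs) fs
    (List.finRange fs.length) (List.ofFn w.symm) hL hs (List.nodup_finRange _)
    (by simp only [map_get_blockPositions, List.map_get_finRange, List.Perm.refl])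
    (fun b _ => filter_symm_eq_blockPositions fs w hw col hcol b) (fun _ _ => List.mem_finRange _)
    (by rwa [List.map_ofFn])
  simp only [map_get_blockPositions] at hTfs
  have hTlen : T.length = fs.length := by simpa using hT.length_eq
  have hTnd : T.Nodup := hT.nodup_iff.2 (List.nodup_finRange _)
  let σ : Fin fs.length → Fin fs.length := fun j => T.get (j.cast hTlen.symm)
  have hσ : Function.Injective σ := fun i j hij => by
    simpa [Fin.ext_iff] using hTnd.get_inj_iff.1 hij
  have hσfs : ∀ j, fs.get (σ j) = fs.get j := by
    intro j
    have : (T.map fs.get)[(j : ℕ)]? = fs[(j : ℕ)]? := by rw [hTfs]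
    simpa [σ, hTlen] using this
  let e := Equiv.ofBijective σ (Finite.injective_iff_bijective.1 hσ)
  have he : ∀ b, σ (e.symm b) = b := fun b => e.apply_symm_apply b
  have hcells : (T.map (blockPositions fs)).map List.length = fs.map List.length := by
    conv_rhs => rw [← hTfs]
    simp [blockPositions]
  refine ⟨e.symm, fun b => ?_, fun b m hm hi hj => ?_⟩
  · rw [← hσfs, he]
  · rw [← Equiv.eq_symm_apply]
    have hb : ((e.symm b : Fin fs.length) : ℕ) < (T.map (blockPositions fs)).length := by
      simp [hTlen]
    have hTb : T[((e.symm b : Fin fs.length) : ℕ)]'(by simp [hTlen]) = b := he b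
    have h1 := getElem?_flatten_sum_take_add (T.map (blockPositions fs)) hb (m := m)
      (by simpa [hTb, blockPositions] using hm)
    rw [hcells, ← List.flatMap_def, ← hz, List.getElem?_ofFn, dif_pos hj] at h1
    simp only [List.getElem_map, hTb, blockPositions] at h1
    rw [List.getElem?_ofFn, dif_pos hm] at h1
    exact (Option.some.inj h1).symm

end BlockPosition

/-- For `a = p₁^{n₁} ⋯ p_s^{n_s}` with `p₁ < ⋯ < p_s` Lyndon, a shuffle `w`
(for the block sizes of the Lyndon factors) fixes `a` if and only if `w` lies
in the subgroup `Σ_{n₁} × ⋯ × Σ_{n_s}` of block permutations, permuting for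
each `i` only the `nᵢ` copies of `pᵢ` among themselves. -/
theorem shuffle_fixes_iff_blockPerm {X : Type*} [LinearOrder X]
    (ps : List (List X)) (ns : List ℕ)
    (hly : ∀ p ∈ ps, IsLyndon p)
    (hsorted : ps.Chain' wlt)
    (hpos : ∀ n ∈ ns, 0 < n)
    (hlen : ns.length = ps.length)
    (fs : List (List X))
    (hfs : fs = (ps.zip ns).flatMap fun pn => List.replicate pn.2 pn.1)
    (w : Equiv.Perm (Fin fs.flatten.length))
    (hw : IsShuffle (fs.map List.length) w) :
    (List.ofFn fun j => fs.flatten.get (w.symm j)) = fs.flatten ↔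
      IsBlockPerm fs w := by
  have hL : ∀ q ∈ fs, IsLyndon q := by
    intro q hq
    rw [hfs, List.mem_flatMap] at hq
    obtain ⟨pn, hpn, hq⟩ := hq
    rw [List.eq_of_mem_replicate hq]
    exact hly _ (List.of_mem_zip hpn).1
  have hps : ps.Pairwise wlt :=
    
    have : Trans (α := List X) wlt wlt wlt := ⟨wlt_trans⟩
    List.isChain_iff_pairwise.1 hsorted
  have hzip : (ps.zip ns).Pairwise fun a b => wlt a.1 b.1 := by
    rw [← List.pairwise_map (f := Prod.fst), List.map_fst_zip hlen.ge]
    exact hps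
  have hs : fs.Pairwise fun a b => ¬ wlt b a := by
    rw [hfs, List.pairwise_flatMap]
    refine ⟨fun pn _ => ?_, hzip.imp fun hab x hx y hy => ?_⟩
    · exact List.pairwise_replicate.2 (Or.inr (wlt_irrefl _))
    · rw [List.eq_of_mem_replicate hx, List.eq_of_mem_replicate hy]
      exact wlt_asymm hab
  exact ⟨isBlockPerm_of_ofFn_symm_eq fs hL hs w hw, ofFn_symm_eq_of_isBlockPerm fs w⟩
end

section
/- The number of (l₁,...,l₁,...,l_s,...,l_s)-shuffle permutations (with block length lᵢ repeated nᵢ times) that fix the word a = p₁^{n₁} ⋯ p_s^{n_s} (p₁ < ⋯ < p_s Lyndon, pᵢ of length lᵢ) equals n₁! ⋯ n_s!. -/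
namespace LyndonShuffle

/-- Lyndon words for the standard lexicographic order: nonempty words strictly smaller than
each of their proper nonempty suffixes. -/
def Lyndon {Y : Type*} [LinearOrder Y] (p : List Y) : Prop :=
  p ≠ [] ∧ ∀ u v : List Y, u ≠ [] → v ≠ [] → p = u ++ v → p < v

section Words

variable {Y : Type*} [LinearOrder Y]

theorem prefix_or_forall_append_lt {a b : List Y} (h : a < b) :
    (∃ e, e ≠ [] ∧ b = a ++ e) ∨ ∀ s t, a ++ s < b ++ t := by
  induction a generalizing b with
  | nil => exact Or.inl ⟨b, by rintro rfl; simp at h, rfl⟩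
  | cons x a ih =>
    cases b with
    | nil => simp at h
    | cons y b =>
      rw [List.cons_lt_cons_iff] at h
      rcases h with h | ⟨rfl, h⟩
      · right; intro s t
        simp [List.cons_lt_cons_iff, h]
      · rcases ih h with ⟨e, he, rfl⟩ | h'
        · exact Or.inl ⟨e, he, rfl⟩
        · right; intro s t
          simpa [List.cons_lt_cons_iff] using h' s t

theorem append_lt_append_left_iff (a : List Y) {b c : List Y} : a ++ b < a ++ c ↔ b < c := by
  induction a with
  | nil => rfl
  | cons x a ih => simpa [List.cons_lt_cons_iff] using ih

theorem append_le_append_left_iff (a : List Y) {b c : List Y} : a ++ b ≤ a ++ c ↔ b ≤ c := by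
  rw [← not_lt, ← not_lt, append_lt_append_left_iff]

theorem lt_append (a : List Y) {e : List Y} (he : e ≠ []) : a < a ++ e := by
  obtain ⟨y, e, rfl⟩ := List.exists_cons_of_ne_nil he
  simpa using (append_lt_append_left_iff a (b := []) (c := y :: e)).2 (by simp)

theorem append_lt_append_of_length_eq {a b : List Y} (h : a < b) (hl : a.length = b.length)
    (s t : List Y) : a ++ s < b ++ t := by
  rcases prefix_or_forall_append_lt h with ⟨e, he, rfl⟩ | h
  · exact absurd hl (by simpa using he)
  · exact h s t

theorem append_lt_append_comm {c h : List Y} (hh : Lyndon h) (hc : c ≠ []) (hlt : c < h) :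
    c ++ h < h ++ c := by
  rcases prefix_or_forall_append_lt hlt with ⟨e, he, rfl⟩ | h'
  · have := hh.2 c e hc he rfl
    rw [List.append_assoc c e c, append_lt_append_left_iff]
    exact this.trans (lt_append e hc)
  · exact h' h c

theorem Lyndon.append {c d : List Y} (hc : Lyndon c) (hd : Lyndon d) (hlt : c < d) :
    Lyndon (c ++ d) := by
  have key : c ++ d < d := by
    rcases prefix_or_forall_append_lt hlt with ⟨e, he, rfl⟩ | h'
    · rw [append_lt_append_left_iff]
      exact hd.2 c e hc.1 he rfl
    · simpa using h' d []
  refine ⟨by simp [hc.1], fun u v hu hv h => ?_⟩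
  rcases List.append_eq_append_iff.1 h with ⟨s, rfl, hs⟩ | ⟨s, hs, rfl⟩
  · rcases eq_or_ne s [] with rfl | hs'
    · obtain rfl : d = v := by simpa using hs
      simpa using key
    · exact key.trans (hd.2 s v hs' hv hs)
  · rcases eq_or_ne s [] with rfl | hs'
    · simpa using key
    · have h1 := hc.2 u s hu hs' hs
      rcases prefix_or_forall_append_lt h1 with ⟨e, he, h2⟩ | h'
      · have := congrArg List.length (h2 ▸ hs)
        have := List.length_pos_iff.2 hu
        simp at *
        omega
      · exact h' d d

theorem lyndon_singleton (x : Y) : Lyndon [x] := by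
  refine ⟨by simp, fun u v hu hv h => ?_⟩
  have := congrArg List.length h
  have := List.length_pos_iff.2 hu
  have := List.length_pos_iff.2 hv
  simp at *
  omega

theorem Lyndon.exists_flatten_eq_append {c : List Y} (hc : Lyndon c) {L : List (List Y)}
    (hL : ∀ p ∈ L, Lyndon p) (hs : L.Pairwise (· ≥ ·)) :
    ∃ V : List (List Y), V.flatten = c ++ L.flatten ∧ (∀ p ∈ V, Lyndon p) ∧
      V.Pairwise (· ≥ ·) := by
  induction L generalizing c with
  | nil => exact ⟨[c], by simp, by simpa using hc, by simp⟩
  | cons d L ih =>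
    simp only [List.forall_mem_cons, List.pairwise_cons] at hL hs
    by_cases h : c < d
    · obtain ⟨V, h1, h2⟩ := ih (hc.append hL.1 h) hL.2 hs.2
      exact ⟨V, by simpa using h1, h2⟩
    · refine ⟨c :: d :: L, by simp, by simp [hc, hL.1]; exact hL.2, ?_⟩
      have h := not_lt.1 h
      simp only [List.pairwise_cons, List.forall_mem_cons]
      exact ⟨⟨h, fun a ha => (hs.1 a ha).trans h⟩, hs⟩

/-- Every word is a nonincreasing product of Lyndon words. -/
theorem exists_lyndon_factorization (v : List Y) :
    ∃ V : List (List Y), V.flatten = v ∧ (∀ p ∈ V, Lyndon p) ∧ V.Pairwise (· ≥ ·) := by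
  induction v with
  | nil => exact ⟨[], by simp⟩
  | cons x v ih =>
    obtain ⟨L, rfl, hL, hs⟩ := ih
    exact (lyndon_singleton x).exists_flatten_eq_append hL hs

theorem Lyndon.lt_of_mem_factorization {u : List Y} (hu : u ≠ []) {V : List (List Y)}
    (hg : Lyndon (u ++ V.flatten)) (hV : ∀ p ∈ V, Lyndon p) (hs : V.Pairwise (· ≥ ·)) :
    ∀ d ∈ V, u ++ V.flatten < d := by
  rcases List.eq_nil_or_concat V with rfl | ⟨W, l, rfl⟩
  · simp
  · rw [List.concat_eq_append] at *
    intro d hd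
    have h1 : u ++ (W ++ [l]).flatten < l :=
      hg.2 (u ++ W.flatten) l (by simp [hu]) (hV l (by simp)).1 (by simp)
    rcases List.mem_append.1 hd with hd | hd
    · exact h1.trans_le ((List.pairwise_append.1 hs).2.2 d hd l (by simp))
    · rw [List.mem_singleton.1 hd]; exact h1

/-- Moving the letters of a Lyndon word `f = c ++ V.flatten` to its sorted place in a
nonincreasing product of Lyndon words increases the product, strictly if `f` meets a larger
factor. -/
theorem append_flatten_le_of_perm {f : List Y} {T : List (List Y)} (hT : T.Pairwise (· ≥ ·))
    {c : List Y} {V H S : List (List Y)} (hc : c ≠ []) (hTp : T.Perm (V ++ H))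
    (hV : V.Pairwise (· ≥ ·)) (hVf : ∀ d ∈ V, f < d) (hcV : c ++ V.flatten = f)
    (hH : ∀ h ∈ H, Lyndon h) (hS : S.Pairwise (· ≥ ·)) (hSp : S.Perm (f :: H)) :
    c ++ T.flatten ≤ S.flatten ∧ ((∃ h ∈ H, f < h) → c ++ T.flatten < S.flatten) := by
  induction T generalizing c V H S with
  | nil =>
    obtain ⟨rfl, rfl⟩ : V = [] ∧ H = [] := by simpa using hTp
    obtain rfl : S = [f] := by simpa using hSp
    simp_all
  | cons d T ih =>
    rw [List.pairwise_cons] at hT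
    have hmax : ∀ a ∈ V ++ H, a ≤ d := fun a ha => by
      rcases List.mem_cons.1 (hTp.symm.subset ha) with rfl | h
      · exact le_rfl
      · exact hT.1 a h
    by_cases hdV : d ∈ V
    · obtain ⟨v, V, rfl⟩ := List.exists_cons_of_ne_nil (List.ne_nil_of_mem hdV)
      have hdv : d = v := by
        refine le_antisymm ?_ (hmax v (by simp))
        rcases List.mem_cons.1 hdV with rfl | h
        · exact le_rfl
        · exact (List.pairwise_cons.1 hV).1 d h
      subst hdv
      have := ih hT.2 (c := c ++ d) (V := V) (H := H) (S := S) (by simp [hc])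
        (by simpa using hTp) (List.pairwise_cons.1 hV).2 (fun a ha => hVf a (by simp [ha]))
        (by simpa using hcV) hH hS hSp
      simpa using this
    · have hdH : d ∈ H := by
        have : d ∈ V ++ H := hTp.subset (by simp)
        simpa [hdV] using this
      by_cases hfd : f < d
      · have hHe := List.perm_cons_erase hdH
        obtain ⟨S', rfl⟩ : ∃ S', S = d :: S' := by
          obtain ⟨s, S', rfl⟩ := List.exists_cons_of_ne_nil
            (List.ne_nil_of_mem (hSp.symm.subset (List.mem_cons_self)))
          refine ⟨S', ?_⟩
          congr 1
          apply le_antisymm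
          · rcases List.mem_cons.1 (hSp.subset (List.mem_cons_self (a := s))) with rfl | h
            · exact hfd.le
            · exact hmax s (by simp [h])
          · rcases List.mem_cons.1 (hSp.symm.subset (List.mem_cons_of_mem f hdH)) with rfl | h
            · exact le_rfl
            · exact (List.pairwise_cons.1 hS).1 d h
        have h1 := (ih hT.2 (c := c) (V := V) (H := H.erase d) (S := S') hc
          (List.Perm.cons_inv (a := d)
            ((hTp.trans (hHe.append_left V)).trans List.perm_middle)) hV hVf hcV
          (fun h hh => hH h (List.mem_of_mem_erase hh)) (List.pairwise_cons.1 hS).2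
          (List.Perm.cons_inv (a := d)
            ((hSp.trans (hHe.cons f)).trans (List.Perm.swap _ _ _)))).1
        have hcd : c < d := lt_of_le_of_lt (by
          rw [← hcV]
          rcases eq_or_ne V.flatten [] with h | h
          · simp [h]
          · exact (lt_append c h).le) hfd
        have h2 : c ++ (d :: T).flatten < (d :: S').flatten := by
          have h3 := append_lt_append_of_length_eq (append_lt_append_comm (hH d hdH) hc hcd)
            (by simp [Nat.add_comm]) T.flatten T.flatten
          have h4 := (append_le_append_left_iff d).2 h1
          simp only [List.flatten_cons, List.append_assoc] at h3 ⊢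
          exact h3.trans_le h4
        exact ⟨h2.le, fun _ => h2⟩
      · have hdf := not_lt.1 hfd
        obtain rfl : V = [] := by
          rw [List.eq_nil_iff_forall_not_mem]
          intro a ha
          exact absurd ((hVf a ha).trans_le ((hmax a (by simp [ha])).trans hdf)) (lt_irrefl _)
        obtain rfl : c = f := by simpa using hcV
        have hST : S = c :: d :: T := by
          refine List.Perm.eq_of_pairwise (le := (· ≥ ·)) (fun a b _ _ h1 h2 => le_antisymm h2 h1)
            hS ?_ (hSp.trans ((List.Perm.cons c (by simpa using hTp)).symm))
          simp only [List.pairwise_cons, List.forall_mem_cons]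
          exact ⟨⟨hdf, fun a ha => (hT.1 a ha).trans hdf⟩, hT⟩
        refine ⟨by simp [hST], ?_⟩
        rintro ⟨h, hh, hlt⟩
        exact absurd (hlt.trans_le ((hmax h (by simpa using hh)).trans hdf)) (lt_irrefl _)

end Words

section Interleavings

variable {Y ι : Type*}

/-- The multiset of all factors in a family of factorizations. -/
def factors [Fintype ι] (L : ι → List (List Y)) : Multiset (List Y) :=
  ∑ j, (L j : Multiset (List Y))

theorem mem_factors [Fintype ι] {L : ι → List (List Y)} {p : List Y} :
    p ∈ factors L ↔ ∃ j, p ∈ L j := by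
  simp [factors, Multiset.mem_sum]

variable [DecidableEq ι]

theorem factors_update [Fintype ι] (L : ι → List (List Y)) (i : ι) (W : List (List Y)) :
    factors (Function.update L i W) = W + ∑ j ∈ Finset.univ \ {i}, (L j : Multiset (List Y)) := by
  rw [factors, ← Finset.sum_update_of_mem (Finset.mem_univ i)]
  refine Finset.sum_congr rfl fun j _ => ?_
  by_cases h : j = i
  · subst h; simp
  · simp [h]

theorem factors_eq [Fintype ι] (L : ι → List (List Y)) (i : ι) :
    factors L = L i + ∑ j ∈ Finset.univ \ {i}, (L j : Multiset (List Y)) := by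
  conv_lhs => rw [← Function.update_eq_self i L]
  exact factors_update L i (L i)

/-- The labelled word `z` is an interleaving of the words `(L i).flatten`: for every label `i`,
the letters of `z` labelled `i` spell `(L i).flatten`. -/
def IsInterleaving (L : ι → List (List Y)) (z : List (ι × Y)) : Prop :=
  ∀ i, (z.filter (fun p => p.1 = i)).map Prod.snd = (L i).flatten

theorem IsInterleaving.tail {L : ι → List (List Y)} {z : List (ι × Y)} {i : ι} {x : Y}
    (h : IsInterleaving L ((i, x) :: z)) {W : List (List Y)}
    (hW : x :: W.flatten = (L i).flatten) : IsInterleaving (Function.update L i W) z := by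
  intro j
  have hj := h j
  by_cases hij : i = j
  · subst hij
    simp only [← hW] at hj
    simpa using hj
  · simpa [hij, Function.update_of_ne (Ne.symm hij)] using hj

variable [LinearOrder Y]

/-- Reading one letter of an interleaving of Lyndon words, and refactoring what is left of the
word it was taken from. -/
theorem IsInterleaving.exists_refactor {L : ι → List (List Y)} {z : List (ι × Y)} {i : ι} {x : Y}
    (h : IsInterleaving L ((i, x) :: z)) (hL : ∀ j, ∀ p ∈ L j, Lyndon p) :
    ∃ V G : List (List Y), L i = (x :: V.flatten) :: G ∧ (∀ p ∈ V, Lyndon p) ∧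
      V.Pairwise (· ≥ ·) ∧ (∀ d ∈ V, x :: V.flatten < d) ∧
      IsInterleaving (Function.update L i (V ++ G)) z := by
  have hi := h i
  cases hLi : L i with
  | nil => simp [hLi] at hi
  | cons p G =>
    have hp : Lyndon p := hL i p (by simp [hLi])
    obtain ⟨y, g, rfl⟩ := List.exists_cons_of_ne_nil hp.1
    obtain ⟨V, rfl, hV, hs⟩ := exists_lyndon_factorization g
    have hxy : x = y := by simp [hLi] at hi; exact hi.1
    subst hxy
    exact ⟨V, G, rfl, hV, hs, Lyndon.lt_of_mem_factorization (u := [x]) (by simp) hp hV hs,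
      h.tail (by simp [hLi])⟩

theorem lyndon_of_mem_update {L : ι → List (List Y)} (hL : ∀ j, ∀ p ∈ L j, Lyndon p) {i : ι}
    {W : List (List Y)} (hW : ∀ p ∈ W, Lyndon p) :
    ∀ j, ∀ p ∈ Function.update L i W j, Lyndon p := by
  intro j
  by_cases h : j = i
  · subst h; simpa using hW
  · simpa [h] using hL j

variable [Fintype ι]

/-- Reading a letter from the factor `x :: V.flatten` before the best possible continuation gives
at most the nonincreasing product of all the factors, and less if that factor is not maximal. -/
theorem cons_flatten_le {L : ι → List (List Y)} {i : ι} {x : Y} {V G S T : List (List Y)}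
    (hL : ∀ j, ∀ p ∈ L j, Lyndon p) (hLi : L i = (x :: V.flatten) :: G)
    (hV : V.Pairwise (· ≥ ·)) (hVf : ∀ d ∈ V, x :: V.flatten < d)
    (hS : S.Pairwise (· ≥ ·)) (hSf : (S : Multiset (List Y)) = factors L)
    (hT : T.Pairwise (· ≥ ·))
    (hTf : (T : Multiset (List Y)) = factors (Function.update L i (V ++ G))) :
    x :: T.flatten ≤ S.flatten ∧
      ((∃ h ∈ S, x :: V.flatten < h) → x :: T.flatten < S.flatten) := by
  set R : Multiset (List Y) := ∑ j ∈ Finset.univ \ {i}, (L j : Multiset (List Y))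
  have hSp : S.Perm ((x :: V.flatten) :: (G ++ R.toList)) := by
    rw [← Multiset.coe_eq_coe, hSf, factors_eq L i, hLi, ← Multiset.cons_coe, ← Multiset.cons_coe,
      ← Multiset.coe_add, Multiset.coe_toList, Multiset.cons_add]
  have hTp : T.Perm (V ++ (G ++ R.toList)) := by
    rw [← Multiset.coe_eq_coe, hTf, factors_update, ← Multiset.coe_add, ← Multiset.coe_add,
      ← Multiset.coe_add, Multiset.coe_toList, add_assoc]
  have hH : ∀ h ∈ G ++ R.toList, Lyndon h := fun h hh => by
    have : h ∈ factors L := by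
      rw [← hSf]; exact Multiset.mem_coe.2 (hSp.symm.subset (List.mem_cons_of_mem _ hh))
    obtain ⟨j, hj⟩ := mem_factors.1 this
    exact hL j h hj
  have := append_flatten_le_of_perm hT (c := [x]) (by simp) hTp hV hVf (by simp) hH hS hSp
  refine ⟨by simpa using this.1, ?_⟩
  rintro ⟨h, hh, hlt⟩
  simpa using this.2 ⟨h, (List.mem_cons.1 (hSp.subset hh)).resolve_left hlt.ne', hlt⟩

/-- The largest interleaving of Lyndon words is their nonincreasing product. -/
theorem IsInterleaving.map_snd_le {z : List (ι × Y)} {L : ι → List (List Y)}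
    (h : IsInterleaving L z) (hL : ∀ j, ∀ p ∈ L j, Lyndon p) {S : List (List Y)}
    (hS : S.Pairwise (· ≥ ·)) (hSf : (S : Multiset (List Y)) = factors L) :
    z.map Prod.snd ≤ S.flatten := by
  induction z generalizing L S with
  | nil => exact not_lt.1 (by simp)
  | cons p z ih =>
    obtain ⟨i, x⟩ := p
    obtain ⟨V, G, hLi, hV, hs, hVf, hz⟩ := h.exists_refactor hL
    have hG : ∀ p ∈ V ++ G, Lyndon p := by
      intro p hp
      rcases List.mem_append.1 hp with hp | hp
      · exact hV p hp
      · exact hL i p (by simp [hLi, hp])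
    have hT := Multiset.pairwise_sort (factors (Function.update L i (V ++ G))) (· ≥ ·)
    have h1 := ih hz (lyndon_of_mem_update hL hG) hT (by simp)
    have h2 := (cons_flatten_le hL hLi hs hVf hS hSf hT (by simp)).1
    exact le_trans ((append_le_append_left_iff [x]).2 h1) h2

/-- If an interleaving of Lyndon words is the largest one, its first letter comes from a
maximal factor. -/
theorem IsInterleaving.le_of_map_snd_eq {z : List (ι × Y)} {L : ι → List (List Y)} {i : ι} {x : Y}
    (h : IsInterleaving L ((i, x) :: z)) (hL : ∀ j, ∀ p ∈ L j, Lyndon p) {S : List (List Y)}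
    (hS : S.Pairwise (· ≥ ·)) (hSf : (S : Multiset (List Y)) = factors L)
    (hz : ((i, x) :: z).map Prod.snd = S.flatten) :
    ∃ V G : List (List Y), L i = (x :: V.flatten) :: G ∧ (∀ p ∈ V, Lyndon p) ∧
      V.Pairwise (· ≥ ·) ∧ (∀ d ∈ V, x :: V.flatten < d) ∧
      IsInterleaving (Function.update L i (V ++ G)) z ∧ ∀ p ∈ S, p ≤ x :: V.flatten := by
  obtain ⟨V, G, hLi, hV, hs, hVf, hz'⟩ := h.exists_refactor hL
  refine ⟨V, G, hLi, hV, hs, hVf, hz', ?_⟩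
  by_contra! hcon
  have hG : ∀ p ∈ V ++ G, Lyndon p := by
    intro p hp
    rcases List.mem_append.1 hp with hp | hp
    · exact hV p hp
    · exact hL i p (by simp [hLi, hp])
  have hT := Multiset.pairwise_sort (factors (Function.update L i (V ++ G))) (· ≥ ·)
  have h1 := hz'.map_snd_le (lyndon_of_mem_update hL hG) hT (by simp)
  have h2 := (cons_flatten_le hL hLi hs hVf hS hSf hT (by simp)).2 hcon
  have h3 := lt_of_le_of_lt ((append_le_append_left_iff [x]).2 h1) h2
  rw [← hz] at h3
  simp at h3

/-- Once the largest interleaving has started reading a Lyndon word labelled `i`, it reads it to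
the end. -/
theorem IsInterleaving.exists_eq_append {z : List (ι × Y)} {L : ι → List (List Y)} {i : ι}
    (h : IsInterleaving L z) (hL : ∀ j, ∀ p ∈ L j, Lyndon p) {f : List Y} {R : List (List Y)}
    (hs : (L i).Pairwise (· ≥ ·)) (hf : ∀ p ∈ L i, f < p) (hR : R.Pairwise (· ≥ ·))
    (hRf : (R : Multiset (List Y)) = factors (Function.update L i [])) (hRle : ∀ p ∈ R, p ≤ f)
    (hz : z.map Prod.snd = (L i).flatten ++ R.flatten) :
    ∃ z', z = (L i).flatten.map (Prod.mk i) ++ z' ∧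
      IsInterleaving (Function.update L i []) z' ∧ z'.map Prod.snd = R.flatten := by
  induction z generalizing L with
  | nil =>
    have : (L i).flatten = [] ∧ R.flatten = [] := by simpa using hz
    refine ⟨[], by simp [this.1], ?_, by simp [this.2]⟩
    intro j
    by_cases hj : j = i
    · subst hj; simp
    · simpa [hj] using h j
  | cons p z ih =>
    obtain ⟨k, x⟩ := p
    cases hLi : L i with
    | nil =>
      refine ⟨(k, x) :: z, by simp, ?_, by simpa [hLi] using hz⟩
      rw [← hLi, Function.update_eq_self]
      exact h
    | cons q Q =>
      have hRL : (R : Multiset (List Y)) = ∑ j ∈ Finset.univ \ {i}, (L j : Multiset (List Y)) := by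
        rw [hRf, factors_update]; simp
      have hS : (L i ++ R).Pairwise (· ≥ ·) :=
        List.pairwise_append.2 ⟨hs, hR, fun a ha b hb => (hRle b hb).trans (hf a ha).le⟩
      have hSf : ((L i ++ R : List (List Y)) : Multiset (List Y)) = factors L := by
        rw [factors_eq L i, ← Multiset.coe_add, hRL]
      obtain ⟨V, G, hLk, hV, hVs, hVf, hz', hmax⟩ :=
        h.le_of_map_snd_eq hL hS hSf (by simpa using hz)
      have hq : f < q := hf q (by simp [hLi])
      have hki : k = i := by
        by_contra hki
        have h1 : x :: V.flatten ∈ R := by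
          rw [← Multiset.mem_coe, hRf, mem_factors]
          exact ⟨k, by simp [hki, hLk]⟩
        exact absurd (hq.trans_le ((hmax q (by simp [hLi])).trans (hRle _ h1))) (lt_irrefl _)
      subst hki
      obtain ⟨rfl, rfl⟩ : q = x :: V.flatten ∧ Q = G := by simpa [hLi] using hLk
      rw [hLi] at hs hf
      rw [List.pairwise_cons] at hs
      have hVG : ∀ p ∈ V ++ Q, Lyndon p := by
        intro p hp
        rcases List.mem_append.1 hp with hp | hp
        · exact hV p hp
        · exact hL k p (by simp [hLi, hp])
      obtain ⟨z', h1, h2, h3⟩ := ih hz' (lyndon_of_mem_update hL hVG)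
        (by
          simp only [Function.update_self]
          exact List.pairwise_append.2 ⟨hVs, hs.2, fun a ha b hb =>
            (hs.1 b hb).trans (hVf a ha).le⟩)
        (by
          simp only [Function.update_self]
          intro p hp
          rcases List.mem_append.1 hp with hp | hp
          · exact hq.trans (hVf p hp)
          · exact hf p (by simp [hp]))
        (by simpa using hRf) (by simpa [hLi] using hz)
      refine ⟨z', ?_, by simpa using h2, h3⟩
      simpa using h1

/-- An interleaving of Lyndon words `f i` (each used at most once) that spells their nonincreasing
product reads the words one after the other. -/
theorem IsInterleaving.exists_eq_flatten {R : List (List Y)} {f : ι → List Y} {z : List (ι × Y)}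
    {L : ι → List (List Y)} (h : IsInterleaving L z) (hf : ∀ i, Lyndon (f i))
    (hL : ∀ j, L j = [] ∨ L j = [f j]) (hR : R.Pairwise (· ≥ ·))
    (hRf : (R : Multiset (List Y)) = factors L) (hz : z.map Prod.snd = R.flatten) :
    ∃ s : List ι, s.map f = R ∧ z = (s.map fun i => (f i).map (Prod.mk i)).flatten := by
  induction R generalizing z L with
  | nil => exact ⟨[], rfl, by simpa using hz⟩
  | cons g R ih =>
    have hLl : ∀ j, ∀ p ∈ L j, Lyndon p := by
      intro j p hp
      rcases hL j with h0 | h0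
      · simp [h0] at hp
      · rw [h0, List.mem_singleton] at hp
        exact hp ▸ hf j
    have hg : Lyndon g := by
      have : g ∈ factors L := by rw [← hRf]; simp
      obtain ⟨j, hj⟩ := mem_factors.1 this
      exact hLl j g hj
    cases z with
    | nil => simp [hg.1] at hz
    | cons p z =>
      obtain ⟨i, x⟩ := p
      obtain ⟨V, G, hLi, hV, hVs, hVf, hz', hmax⟩ := h.le_of_map_snd_eq hLl hR hRf hz
      rw [List.pairwise_cons] at hR
      obtain ⟨hfi, rfl⟩ : f i = x :: V.flatten ∧ G = [] := by
        rcases hL i with h0 | h0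
        · simp [h0] at hLi
        · simpa [h0] using hLi
      have hfg : g = f i := by
        refine le_antisymm (hfi ▸ hmax g (by simp)) ?_
        have : f i ∈ g :: R := by
          rw [← Multiset.mem_coe, hRf, mem_factors]
          exact ⟨i, by simp [hLi, hfi]⟩
        rcases List.mem_cons.1 this with h0 | h0
        · exact h0.le
        · exact hR.1 _ h0
      subst hfg
      have hRf' : (R : Multiset (List Y)) = factors (Function.update L i []) := by
        rw [factors_eq L i, hLi, ← hfi, ← Multiset.cons_coe, ← Multiset.cons_coe,
          Multiset.cons_add, Multiset.cons_inj_right] at hRf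
        rw [factors_update]
        exact hRf
      obtain ⟨z', h1, h2, h3⟩ := hz'.exists_eq_append (f := f i)
        (lyndon_of_mem_update hLl (by simpa using hV)) (i := i) (R := R) (by simpa using hVs)
        (by simpa [hfi] using hVf) hR.2 (by simpa using hRf') hR.1
        (by rw [hfi] at hz; simpa using hz)
      obtain ⟨s, hs1, hs2⟩ := ih (z := z') (L := Function.update L i []) (by simpa using h2)
        (by
          intro j
          by_cases hj : j = i
          · subst hj; simp
          · simpa [hj] using hL j) hR.2 hRf' h3
      refine ⟨i :: s, by simp [hs1], ?_⟩
      simp [h1, hfi, ← hs2]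

end Interleavings

section Blocks

theorem getElem?_flatten_sum_take {α : Type*} (A : List (List α)) (i j : ℕ) (hi : i < A.length)
    (hj : j < A[i].length) : A.flatten[((A.map List.length).take i).sum + j]? = A[i][j]? := by
  induction A generalizing i with
  | nil => simp at hi
  | cons p A ih =>
    cases i with
    | zero =>
      have hj' : j < p.length := by simpa using hj
      simp [List.getElem?_append_left hj']
    | succ i =>
      have := ih i (by simpa using hi) (by simpa using hj)
      simp only [List.map_cons, List.take_succ_cons, List.sum_cons, List.flatten_cons, add_assoc]
      rw [List.getElem?_append_right (by omega)]
      simpa using this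

/-- The positions of a concatenation, as pairs of a block and a position in this block. -/
theorem exists_blockEquiv {α : Type*} (fs : List (List α)) :
    ∃ E : (Σ i : Fin fs.length, Fin (fs.get i).length) ≃ Fin fs.flatten.length,
      ∀ i j, (E ⟨i, j⟩ : ℕ) = ((fs.map List.length).take i).sum + j := by
  have hn : ∑ i : Fin fs.length, (fs.get i).length = fs.flatten.length := by
    rw [List.length_flatten, ← List.sum_ofFn]
    congr 1
    exact List.ext_getElem (by simp) (by simp)
  refine ⟨finSigmaFinEquiv.trans (finCongr hn), fun i j => ?_⟩
  simp only [Equiv.trans_apply, finCongr_apply, Fin.val_cast, finSigmaFinEquiv_apply]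
  congr 1
  rw [← List.sum_ofFn]
  congr 1
  exact List.ext_getElem (by simp [i.2.le]) (by simp)

variable {α : Type*} {fs : List (List α)}
  {E : (Σ i : Fin fs.length, Fin (fs.get i).length) ≃ Fin fs.flatten.length}

theorem get_flatten_blockEquiv
    (hE : ∀ i j, (E ⟨i, j⟩ : ℕ) = ((fs.map List.length).take i).sum + j)
    (i : Fin fs.length) (j : Fin (fs.get i).length) :
    fs.flatten.get (E ⟨i, j⟩) = (fs.get i).get j := by
  have := getElem?_flatten_sum_take fs i j i.2 j.2
  rw [← hE] at this
  exact Option.some_inj.1 ((List.getElem?_eq_getElem (E ⟨i, j⟩).2).symm.trans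
    (this.trans (List.getElem?_eq_getElem j.2)))

theorem isShuffle_iff (hE : ∀ i j, (E ⟨i, j⟩ : ℕ) = ((fs.map List.length).take i).sum + j)
    (w : Equiv.Perm (Fin fs.flatten.length)) :
    IsShuffle (fs.map List.length) w ↔
      ∀ i, StrictMono fun j : Fin (fs.get i).length => w (E ⟨i, j⟩) := by
  have hsucc : ∀ i (hi : i < fs.length), ((fs.map List.length).take (i + 1)).sum =
      ((fs.map List.length).take i).sum + fs[i].length := fun i hi => by
    rw [List.sum_take_succ _ i (by simpa using hi)]; simp
  constructor
  · intro h i j j' hjj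
    refine h i _ _ (by rw [hE]; omega) (by rw [hE, hE]; simpa using hjj) ?_
    rw [hE, hsucc i i.2]
    simp
  · intro h b x y hbx hxy hyb
    by_cases hb : b < fs.length
    · rw [hsucc b hb] at hyb
      have key : ∀ x : Fin fs.flatten.length, ((fs.map List.length).take b).sum ≤ (x : ℕ) →
          (x : ℕ) < ((fs.map List.length).take b).sum + fs[b].length →
          ∃ j, x = E ⟨⟨b, hb⟩, j⟩ ∧
            (x : ℕ) = ((fs.map List.length).take b).sum + j := fun x h1 h2 =>
        have : (x : ℕ) - ((fs.map List.length).take b).sum < fs[b].length := by omega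
        ⟨⟨_, this⟩, by ext; rw [hE]; simp; omega, by simp; omega⟩
      obtain ⟨j, rfl, hj⟩ := key x hbx (by omega)
      obtain ⟨j', rfl, hj'⟩ := key y (by omega) hyb
      exact h _ (Fin.lt_def.2 (by omega))
    · rw [List.take_of_length_le (by simpa using hb), ← List.length_flatten] at hbx
      exact absurd x.2 (by omega)

theorem ofFn_get_symm_eq_iff (a : List α) (w : Equiv.Perm (Fin a.length)) :
    (List.ofFn fun j => a.get (w.symm j)) = a ↔ ∀ j, a.get (w j) = a.get j := by
  conv_lhs => rhs; rw [← List.ofFn_get a]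
  rw [List.ofFn_inj, funext_iff]
  constructor
  · intro h j
    simpa using (h (w j)).symm
  · intro h j
    simpa using (h (w.symm j)).symm

theorem sigma_fin_ext {r : ℕ} {l : Fin r → ℕ} {i i' : Fin r} {j : Fin (l i)} {j' : Fin (l i')}
    (hi : i = i') (hj : (j : ℕ) = j') : (⟨i, j⟩ : Σ i, Fin (l i)) = ⟨i', j'⟩ := by
  subst hi
  rw [Fin.ext hj]

theorem length_get_eq {σ : Fin fs.length → Fin fs.length} (hσ : fs.get ∘ σ = fs.get)
    (i : Fin fs.length) : (fs.get i).length = (fs.get (σ i)).length := by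
  rw [← congrFun hσ i]; rfl

/-- The permutation of the positions induced by a permutation of equal blocks. -/
def blockPerm (E : (Σ i : Fin fs.length, Fin (fs.get i).length) ≃ Fin fs.flatten.length)
    (σ : Equiv.Perm (Fin fs.length)) (hσ : fs.get ∘ σ = fs.get) :
    Equiv.Perm (Fin fs.flatten.length) :=
  E.symm.trans ((Equiv.sigmaCongr σ fun i => finCongr (length_get_eq hσ i)).trans E)

theorem blockPerm_apply (σ : Equiv.Perm (Fin fs.length)) (hσ : fs.get ∘ σ = fs.get)
    (i : Fin fs.length) (j : Fin (fs.get i).length) :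
    blockPerm E σ hσ (E ⟨i, j⟩) = E ⟨σ i, j.cast (length_get_eq hσ i)⟩ := by
  simp [blockPerm, Equiv.sigmaCongr]

theorem blockEquiv_lt_iff (hE : ∀ i j, (E ⟨i, j⟩ : ℕ) = ((fs.map List.length).take i).sum + j)
    {i : Fin fs.length} {j j' : Fin (fs.get i).length} : E ⟨i, j⟩ < E ⟨i, j'⟩ ↔ j < j' := by
  rw [Fin.lt_def, hE, hE, Fin.lt_def]; omega

end Blocks

section Lyndon

variable {Y : Type*} {fs : List (List Y)}
  {E : (Σ i : Fin fs.length, Fin (fs.get i).length) ≃ Fin fs.flatten.length}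

theorem isInterleaving_of_shuffle
    (hE : ∀ i j, (E ⟨i, j⟩ : ℕ) = ((fs.map List.length).take i).sum + j)
    {w : Equiv.Perm (Fin fs.flatten.length)}
    (hw : ∀ i, StrictMono fun j : Fin (fs.get i).length => w (E ⟨i, j⟩))
    (hfix : ∀ j, fs.flatten.get (w j) = fs.flatten.get j) :
    IsInterleaving (fun i => [fs.get i])
      (List.ofFn fun j => ((E.symm (w.symm j)).1, fs.flatten.get j)) := by
  intro i
  have h : (List.finRange fs.flatten.length).filter (fun j => (E.symm (w.symm j)).1 = i) =
      List.ofFn fun k : Fin (fs.get i).length => w (E ⟨i, k⟩) := by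
    refine List.Perm.eq_of_pairwise (le := (· < ·))
      (fun a b _ _ h1 h2 => absurd h1 h2.asymm) ?_ ?_ ?_
    · exact (List.pairwise_lt_finRange _).filter _
    · rw [List.pairwise_ofFn]
      exact fun a b hab => hw i hab
    · rw [List.perm_ext_iff_of_nodup ((List.nodup_finRange _).filter _)
        (List.nodup_ofFn.2 (hw i).injective)]
      intro j
      simp only [List.mem_filter, List.mem_finRange, true_and, decide_eq_true_eq, List.mem_ofFn]
      constructor
      · rintro rfl
        exact ⟨(E.symm (w.symm j)).2, by simp⟩
      · rintro ⟨k, rfl⟩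
        simp
  rw [List.ofFn_eq_map, List.filter_map, List.map_map]
  have h2 : ((fun p : Fin fs.length × Y => decide (p.1 = i)) ∘
      fun j => ((E.symm (w.symm j)).1, fs.flatten.get j)) =
      fun j => decide ((E.symm (w.symm j)).1 = i) := rfl
  rw [h2, h, List.map_ofFn]
  simp only [List.flatten_singleton]
  conv_rhs => rw [← List.ofFn_get (fs.get i)]
  congr 1
  funext k
  simp only [Function.comp_apply, hfix]
  exact get_flatten_blockEquiv hE i k

theorem factors_singleton_get : factors (fun i => [fs.get i]) = (fs : Multiset (List Y)) := by
  have h : factors (fun i => [fs.get i]) = Finset.univ.val.map fs.get := by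
    rw [← Multiset.sum_map_singleton (Finset.univ.val.map fs.get), Multiset.map_map]
    rfl
  rw [h, Fin.univ_val_map, List.ofFn_get]

variable [LinearOrder Y]

/-- A shuffle fixing a nonincreasing product of Lyndon words permutes the factors. -/
theorem exists_blockPerm_eq
    (hE : ∀ i j, (E ⟨i, j⟩ : ℕ) = ((fs.map List.length).take i).sum + j)
    (hfs : ∀ p ∈ fs, Lyndon p) (hs : fs.Pairwise (· ≥ ·))
    {w : Equiv.Perm (Fin fs.flatten.length)}
    (hw : ∀ i, StrictMono fun j : Fin (fs.get i).length => w (E ⟨i, j⟩))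
    (hfix : ∀ j, fs.flatten.get (w j) = fs.flatten.get j) :
    ∃ σ : Equiv.Perm (Fin fs.length), ∃ hσ : fs.get ∘ σ = fs.get, blockPerm E σ hσ = w := by
  obtain ⟨s, hs1, hs2⟩ := (isInterleaving_of_shuffle hE hw hfix).exists_eq_flatten
    (fun i => hfs _ (List.get_mem _ _)) (fun _ => Or.inr rfl) hs factors_singleton_get.symm
    (by rw [List.map_ofFn]; exact List.ofFn_get _)
  have hlen : s.length = fs.length := by simpa using congrArg List.length hs1
  set τ : Fin fs.length → Fin fs.length := fun t => s[(t : ℕ)]'(by rw [hlen]; exact t.2)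
  have hfτ : ∀ t, fs.get (τ t) = fs.get t := fun t => by
    have h := List.getElem_of_eq hs1.symm t.2
    rw [List.getElem_map] at h
    exact h.symm
  have hlab : ∀ t k, (E.symm (w.symm (E ⟨t, k⟩))).1 = τ t := fun t k => by
    have hts : (t : ℕ) < s.length := by rw [hlen]; exact t.2
    have hml : (s.map fun i => (fs.get i).map (Prod.mk i)).map List.length =
        fs.map List.length := by
      conv_rhs => rw [← hs1]
      simp [Function.comp_def]
    have hk : (k : ℕ) < (fs.get (τ t)).length := k.2.trans_eq (congrArg List.length (hfτ t)).symm
    have h := getElem?_flatten_sum_take (s.map fun i => (fs.get i).map (Prod.mk i)) t k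
      (by simpa using hts) (by simpa using hk)
    rw [hml, ← hE, ← hs2] at h
    have h' := congrArg (Option.map Prod.fst) h
    simp only [List.getElem?_ofFn, List.getElem_map, List.getElem?_map, Fin.is_lt] at h'
    simp at h'
    exact h'.2.symm
  have hpos : ∀ t k, w.symm (E ⟨t, k⟩) =
      E ⟨τ t, k.cast (congrArg List.length (hfτ t)).symm⟩ := by
    intro t
    have hg : ∀ k, ∃ g : Fin (fs.get (τ t)).length, w.symm (E ⟨t, k⟩) = E ⟨τ t, g⟩ := fun k => by
      rw [← hlab t k]
      exact ⟨(E.symm (w.symm (E ⟨t, k⟩))).2, by simp⟩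
    choose g hg using hg
    have hmono : StrictMono g := fun k k' hk => by
      by_contra hcon
      have h1 := (hw (τ t)).monotone (not_lt.1 hcon)
      simp only [← hg, Equiv.apply_symm_apply] at h1
      exact absurd ((blockEquiv_lt_iff hE).2 hk) (not_lt.2 h1)
    have hl := congrArg List.length (hfτ t)
    have : StrictMono fun k => (g k).cast hl := fun k k' hk => hmono hk
    have hid := (this.range_inj strictMono_id).1 (by
      rw [Function.Surjective.range_eq (Finite.surjective_of_injective this.injective)]; simp)
    intro k
    rw [hg k]
    congr 2
    have := congrFun hid k
    simp only [id] at this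
    ext
    simpa using congrArg Fin.val this
  have hτi : Function.Injective τ := fun t t' h => by
    have hp : ∀ t : Fin fs.length, 0 < (fs.get t).length := fun t =>
      List.length_pos_iff.2 (hfs _ (List.get_mem _ _)).1
    have h1 : w.symm (E ⟨t, ⟨0, hp t⟩⟩) = w.symm (E ⟨t', ⟨0, hp t'⟩⟩) := by
      rw [hpos, hpos]
      exact congrArg E (sigma_fin_ext (l := fun i => (fs.get i).length) h rfl)
    exact congrArg Sigma.fst (E.injective (w.symm.injective h1))
  set ρ : Equiv.Perm (Fin fs.length) := Equiv.ofBijective τ (Finite.injective_iff_bijective.1 hτi)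
  have hσ : fs.get ∘ ρ.symm = fs.get := by
    funext t
    obtain ⟨t, rfl⟩ := ρ.surjective t
    rw [Function.comp_apply, ρ.symm_apply_apply]
    exact (hfτ t).symm
  refine ⟨ρ.symm, hσ, ?_⟩
  ext1 x
  obtain ⟨x, rfl⟩ := w.symm.surjective x
  obtain ⟨⟨t, k⟩, rfl⟩ := E.surjective x
  rw [Equiv.apply_symm_apply, hpos, blockPerm_apply]
  exact congrArg E (sigma_fin_ext (l := fun i => (fs.get i).length) (ρ.symm_apply_apply t) rfl)

theorem card_shuffles_eq_card_perm (hfs : ∀ p ∈ fs, Lyndon p) (hs : fs.Pairwise (· ≥ ·)) :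
    Nat.card {w : Equiv.Perm (Fin fs.flatten.length) //
        IsShuffle (fs.map List.length) w ∧
        (List.ofFn fun j => fs.flatten.get (w.symm j)) = fs.flatten} =
      Nat.card {σ : Equiv.Perm (Fin fs.length) // fs.get ∘ σ = fs.get} := by
  obtain ⟨E, hE⟩ := exists_blockEquiv fs
  symm
  refine Nat.card_congr (Equiv.ofBijective
    (fun σ => ⟨blockPerm E σ.1 σ.2, (isShuffle_iff hE _).2 ?_, (ofFn_get_symm_eq_iff _ _).2 ?_⟩)
    ⟨?_, ?_⟩)
  · intro i j j' hj
    simp only [blockPerm_apply]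
    exact (blockEquiv_lt_iff hE).2 hj
  · intro x
    obtain ⟨⟨i, j⟩, rfl⟩ := E.surjective x
    rw [blockPerm_apply, get_flatten_blockEquiv hE, get_flatten_blockEquiv hE]
    have := congrFun σ.2 i
    simp only [Function.comp_apply] at this
    simp only [List.get_eq_getElem, Fin.val_cast]
    exact List.getElem_of_eq this _
  · intro σ σ' h
    ext1
    ext1 i
    have hp : 0 < (fs.get i).length := List.length_pos_iff.2 (hfs _ (List.get_mem _ _)).1
    have h1 := Equiv.congr_fun (congrArg Subtype.val h) (E ⟨i, ⟨0, hp⟩⟩)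
    simp only [blockPerm_apply] at h1
    exact congrArg Sigma.fst (E.injective h1)
  · rintro ⟨w, hw, hfix⟩
    obtain ⟨σ, hσ, h⟩ := exists_blockPerm_eq hE hfs hs ((isShuffle_iff hE w).1 hw)
      ((ofFn_get_symm_eq_iff _ _).1 hfix)
    exact ⟨⟨σ, hσ⟩, Subtype.ext h⟩

end Lyndon

section Counting

variable {α : Type*}

theorem mem_of_mem_flatMap_zip {ps : List α} {ns : List ℕ} {a : α}
    (h : a ∈ (ps.zip ns).flatMap fun pn => List.replicate pn.2 pn.1) : a ∈ ps := by
  obtain ⟨⟨p, n⟩, hpn, ha⟩ := List.mem_flatMap.1 h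
  rw [List.eq_of_mem_replicate ha]
  exact (List.of_mem_zip hpn).1

theorem pairwise_flatMap_zip {r : α → α → Prop} (hr : ∀ a, r a a) {ps : List α}
    (hps : ps.Pairwise r) (ns : List ℕ) :
    ((ps.zip ns).flatMap fun pn => List.replicate pn.2 pn.1).Pairwise r := by
  induction ps generalizing ns with
  | nil => simp
  | cons p ps ih =>
    cases ns with
    | nil => simp
    | cons n ns =>
      rw [List.pairwise_cons] at hps
      simp only [List.zip_cons_cons, List.flatMap_cons]
      refine List.pairwise_append.2 ⟨List.pairwise_replicate.2 (Or.inr (hr p)), ih hps.2 ns, ?_⟩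
      intro a ha b hb
      rw [List.eq_of_mem_replicate ha]
      exact hps.1 b (mem_of_mem_flatMap_zip hb)

variable [DecidableEq α]

theorem card_perm_get_comp_eq {fs ps : List α} (hps : ps.Nodup) (hsub : ∀ a ∈ fs, a ∈ ps) :
    Nat.card {σ : Equiv.Perm (Fin fs.length) // fs.get ∘ σ = fs.get} =
      (ps.map fun p => (fs.count p).factorial).prod := by
  have hcount : ∀ p, Fintype.card {a // fs.get a = p} = fs.count p := fun p => by
    conv_rhs => rw [← List.ofFn_get fs, ← Multiset.coe_count, ← Fin.univ_val_map]
    rw [Multiset.count_map, Fintype.card_subtype]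
    simp only [eq_comm (a := p)]
    rfl
  rw [Nat.card_eq_fintype_card, DomMulAct.stabilizer_card']
  simp only [hcount]
  rw [← List.prod_toFinset _ hps]
  refine Finset.prod_subset ?_ ?_
  · intro p hp
    obtain ⟨i, -, rfl⟩ := Finset.mem_image.1 hp
    exact List.mem_toFinset.2 (hsub _ (List.get_mem _ _))
  · intro p _ hp
    have : p ∉ fs := fun h => hp (by
      obtain ⟨i, rfl⟩ := List.get_of_mem h
      simp)
    simp [List.count_eq_zero_of_not_mem this]

theorem map_count_flatMap_zip {ps : List α} {ns : List ℕ} (hps : ps.Nodup)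
    (hlen : ns.length = ps.length) :
    (ps.map fun p => ((ps.zip ns).flatMap fun pn => List.replicate pn.2 pn.1).count p) = ns := by
  induction ps generalizing ns with
  | nil => simpa [eq_comm] using hlen
  | cons p ps ih =>
    cases ns with
    | nil => simp at hlen
    | cons n ns =>
      rw [List.nodup_cons] at hps
      have hp := List.count_eq_zero_of_not_mem (fun h => hps.1 (mem_of_mem_flatMap_zip (ns := ns) h))
      simp only [List.zip_cons_cons, List.flatMap_cons, List.count_append, List.map_cons,
        List.count_replicate_self, hp, add_zero]
      congr 1
      refine Eq.trans (List.map_congr_left fun q hq => ?_) (ih hps.2 (by simpa using hlen))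
      have hqp : p ≠ q := fun h => hps.1 (h ▸ hq)
      simp [List.count_replicate, hqp]

end Counting

section Dual

variable {X : Type*} [LinearOrder X]

theorem wlt_iff (a b : List X) : wlt a b ↔ @LT.lt (List Xᵒᵈ) _ b a := by
  induction a generalizing b with
  | nil => simp only [wlt, false_iff]; exact List.not_lt_nil (α := Xᵒᵈ) b
  | cons x a ih =>
    cases b with
    | nil => simp only [wlt, true_iff]; exact List.nil_lt_cons (α := Xᵒᵈ) x a
    | cons y b =>
      rw [wlt, ih]
      refine Iff.trans ?_ (List.cons_lt_cons_iff (α := Xᵒᵈ)).symm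
      exact or_congr Iff.rfl (and_congr_left' eq_comm)

theorem lyndon_dual {p : List X} (hp : IsLyndon p) : Lyndon (Y := Xᵒᵈ) p :=
  ⟨hp.1, fun u v hu hv h => (wlt_iff (X := X) v p).1 (hp.2 u v hu hv h)⟩

end Dual

end LyndonShuffle

open LyndonShuffle in
/-- The number of `(l₁,…,l₁,…,l_s,…,l_s)`-shuffles (block length `lᵢ` repeated
`nᵢ` times) fixing the word `a = p₁^{n₁} ⋯ p_s^{n_s}` (with `p₁ < ⋯ < p_s`
Lyndon words, `pᵢ` of length `lᵢ`) equals `n₁! ⋯ n_s!`. -/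
theorem card_shuffles_fixing_eq_prod_factorials {X : Type*} [LinearOrder X]
    (ps : List (List X)) (ns : List ℕ)
    (hly : ∀ p ∈ ps, IsLyndon p)
    (hsorted : ps.Chain' wlt)
    (hpos : ∀ n ∈ ns, 0 < n)
    (hlen : ns.length = ps.length)
    (fs : List (List X))
    (hfs : fs = (ps.zip ns).flatMap fun pn => List.replicate pn.2 pn.1) :
    Nat.card {w : Equiv.Perm (Fin fs.flatten.length) //
        IsShuffle (fs.map List.length) w ∧
        (List.ofFn fun j => fs.flatten.get (w.symm j)) = fs.flatten} =
      (ns.map Nat.factorial).prod := by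
  have hpw : ps.Pairwise (fun a b => @GT.gt (List Xᵒᵈ) _ a b) := by
    have h := hsorted.imp fun a b h => (wlt_iff a b).1 h
    exact List.isChain_iff_pairwise.1 h
  have hnodup : ps.Nodup := hpw.imp fun h => (ne_of_gt (α := List Xᵒᵈ) h :)
  have hmem : ∀ p ∈ fs, p ∈ ps := fun p hp => mem_of_mem_flatMap_zip (hfs ▸ hp)
  have hly' : ∀ p ∈ fs, Lyndon (Y := Xᵒᵈ) p := fun p hp => lyndon_dual (hly p (hmem p hp))
  have hfpw : fs.Pairwise (fun a b => @GE.ge (List Xᵒᵈ) _ a b) := by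
    rw [hfs]
    exact pairwise_flatMap_zip (r := fun a b => @GE.ge (List Xᵒᵈ) _ a b)
      (fun a => le_refl (α := List Xᵒᵈ) a)
      (hpw.imp fun h => le_of_lt (α := List Xᵒᵈ) h) ns
  refine (card_shuffles_eq_card_perm (Y := Xᵒᵈ) hly' hfpw).trans ?_
  refine (card_perm_get_comp_eq hnodup hmem).trans ?_
  conv_rhs => rw [← map_count_flatMap_zip hnodup hlen, ← hfs]
  rw [List.map_map]
  rfl
end
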